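/- Let G be a graph on n vertices with maximum degree Δ, and let λ > 0. Let I be a random independent set drawn from the hard-core model on G at activity λ. Then Var(|I|) ≥ nλ/(1+(Δ+1)λ)^2. Equivalently, (Σ_{I indep} |I|^2 λ^{|I|})/P_G(λ) − ( (Σ_{I indep} |I| λ^{|I|})/P_G(λ) )^2 ≥ nλ/(1+(Δ+1)λ)^2. In particular the variance fraction satisfies V_G(λ) ≥ V_{K_{Δ+1}}(λ) = λ/(1+(Δ+1)λ)^2. -/

import Mathlib

open Finset

/- The finset of all independent sets (as finsets of vertices) of a graph `G`. -/
open Classical in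
noncomputable def indepFinsets {V : Type*} [Fintype V] (G : SimpleGraph V) :
    Finset (Finset V) :=
  Finset.univ.filter fun s => ∀ u ∈ s, ∀ v ∈ s, ¬ G.Adj u v

/- The independence polynomial `P_G(x) = Σ_{I independent} x^{|I|}`. -/
noncomputable def indepPoly {V : Type*} [Fintype V] (G : SimpleGraph V) (x : ℝ) : ℝ :=
  ∑ I ∈ indepFinsets G, x ^ I.card

/-- The vertices that can be added to the independent set `s`: those outside `s` with no
neighbour in `s`. -/
noncomputable def freeVertices {V : Type*} [Fintype V] (G : SimpleGraph V) (s : Finset V) :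
    Finset V := by
  classical exact Finset.univ.filter fun v => v ∉ s ∧ ∀ u ∈ s, ¬ G.Adj u v

section HardCore

variable {V : Type*} [Fintype V] {G : SimpleGraph V}

theorem mem_indepFinsets {s : Finset V} :
    s ∈ indepFinsets G ↔ ∀ u ∈ s, ∀ v ∈ s, ¬ G.Adj u v := by
  simp [indepFinsets]

theorem mem_freeVertices {s : Finset V} {v : V} :
    v ∈ freeVertices G s ↔ v ∉ s ∧ ∀ u ∈ s, ¬ G.Adj u v := by
  simp [freeVertices]

theorem indepPoly_pos {lam : ℝ} (hlam : 0 < lam) : 0 < indepPoly G lam :=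
  Finset.sum_pos (fun _ _ => by positivity) ⟨∅, by simp [mem_indepFinsets]⟩

open Classical in
/-- Removing a vertex from an independent set is inverse to adding a free vertex. -/
theorem sum_card_mul_eq_sum_freeVertices (lam : ℝ) (g : Finset V → ℝ) :
    ∑ I ∈ indepFinsets G, (I.card : ℝ) * g I * lam ^ I.card =
      lam * ∑ J ∈ indepFinsets G, (∑ v ∈ freeVertices G J, g (insert v J)) * lam ^ J.card := by
  have hl : ∀ I : Finset V, (I.card : ℝ) * g I * lam ^ I.card =
      ∑ _v ∈ I, g I * lam ^ I.card := fun I => by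
    rw [Finset.sum_const, nsmul_eq_mul, mul_assoc]
  simp_rw [hl, Finset.mul_sum, Finset.sum_mul, Finset.mul_sum]
  rw [Finset.sum_sigma', Finset.sum_sigma']
  refine Finset.sum_bij' (fun p _ => ⟨p.1.erase p.2, p.2⟩) (fun p _ => ⟨insert p.2 p.1, p.2⟩)
    ?_ ?_ ?_ ?_ ?_
  · rintro ⟨I, v⟩ h
    simp only [Finset.mem_sigma, mem_indepFinsets, mem_freeVertices, Finset.mem_erase] at h ⊢
    exact ⟨fun a ha b hb => h.1 a ha.2 b hb.2, by simp, fun u hu => h.1 u hu.2 v h.2⟩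
  · rintro ⟨J, v⟩ h
    simp only [Finset.mem_sigma, mem_indepFinsets, mem_freeVertices, Finset.mem_insert] at h ⊢
    refine ⟨?_, Or.inl trivial⟩
    rintro a (rfl | ha) b (rfl | hb)
    · exact G.loopless.irrefl _
    · exact fun hab => h.2.2 b hb hab.symm
    · exact h.2.2 a ha
    · exact h.1 a ha b hb
  · rintro ⟨I, v⟩ h
    simp only [Finset.mem_sigma] at h
    simp [Finset.insert_erase h.2]
  · rintro ⟨J, v⟩ h
    simp only [Finset.mem_sigma, mem_freeVertices] at h
    simp [Finset.erase_insert h.2.1]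
  · rintro ⟨I, v⟩ h
    simp only [Finset.mem_sigma] at h
    simp only [Finset.insert_erase h.2]
    rw [← Finset.card_erase_add_one h.2, pow_succ]
    ring

open Classical in
/-- Adding a vertex to `s` destroys at most `Δ + 1` free vertices. -/
theorem card_freeVertices_le_insert [DecidableRel G.Adj] (s : Finset V) (v : V) :
    (freeVertices G s).card ≤ (freeVertices G (insert v s)).card + (G.maxDegree + 1) := by
  have hsub : freeVertices G s ⊆
      freeVertices G (insert v s) ∪ insert v (G.neighborFinset v) := by
    intro w hw
    simp only [Finset.mem_union, mem_freeVertices, Finset.mem_insert,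
      SimpleGraph.mem_neighborFinset] at hw ⊢
    by_cases h : w = v ∨ G.Adj v w
    · exact Or.inr h
    · push Not at h
      refine Or.inl ⟨by simp [h.1, hw.1], ?_⟩
      rintro u (rfl | hu)
      · exact h.2
      · exact hw.2 u hu
  have hN : (insert v (G.neighborFinset v)).card ≤ G.maxDegree + 1 :=
    (Finset.card_insert_le _ _).trans (Nat.add_le_add_right (G.degree_le_maxDegree v) 1)
  exact (Finset.card_le_card hsub).trans
    ((Finset.card_union_le _ _).trans (Nat.add_le_add_left hN _))

open Classical in
/-- Each vertex is free or in the closed neighbourhood of a vertex of `s`. -/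
theorem card_le_card_freeVertices_add [DecidableRel G.Adj] (s : Finset V) :
    Fintype.card V ≤ (freeVertices G s).card + s.card * (G.maxDegree + 1) := by
  have hcover : (Finset.univ : Finset V) ⊆
      freeVertices G s ∪ s.biUnion fun v => insert v (G.neighborFinset v) := by
    intro w _
    simp only [Finset.mem_union, mem_freeVertices, Finset.mem_biUnion, Finset.mem_insert,
      SimpleGraph.mem_neighborFinset]
    by_contra! h
    obtain ⟨h1, h2⟩ := h
    obtain ⟨u, hu, huw⟩ := h1 fun hw => (h2 w hw).1 rfl
    exact (h2 u hu).2 huw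
  have hN : (s.biUnion fun v => insert v (G.neighborFinset v)).card ≤
      s.card * (G.maxDegree + 1) :=
    Finset.card_biUnion_le_card_mul _ _ _ fun v _ =>
      (Finset.card_insert_le _ _).trans (Nat.add_le_add_right (G.degree_le_maxDegree v) 1)
  exact (Finset.card_le_card hcover).trans
    ((Finset.card_union_le _ _).trans (Nat.add_le_add_left hN _))

theorem sum_card_eq (lam : ℝ) :
    ∑ I ∈ indepFinsets G, (I.card : ℝ) * lam ^ I.card =
      lam * ∑ I ∈ indepFinsets G, ((freeVertices G I).card : ℝ) * lam ^ I.card := by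
  simpa using sum_card_mul_eq_sum_freeVertices (G := G) lam fun _ => 1

theorem sum_card_sq_eq (lam : ℝ) :
    ∑ I ∈ indepFinsets G, (I.card : ℝ) ^ 2 * lam ^ I.card =
      lam * (∑ I ∈ indepFinsets G, (I.card : ℝ) * (freeVertices G I).card * lam ^ I.card +
        ∑ I ∈ indepFinsets G, ((freeVertices G I).card : ℝ) * lam ^ I.card) := by
  classical
  have h := sum_card_mul_eq_sum_freeVertices (G := G) lam fun I => (I.card : ℝ)
  simp_rw [sq]
  rw [h, ← Finset.sum_add_distrib]
  congr 1
  refine Finset.sum_congr rfl fun J _ => ?_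
  have hc : ∀ v ∈ freeVertices G J, ((insert v J).card : ℝ) = J.card + 1 := fun v hv => by
    rw [Finset.card_insert_of_notMem (mem_freeVertices.1 hv).1]
    push_cast
    rfl
  rw [Finset.sum_congr rfl hc, Finset.sum_const, nsmul_eq_mul]
  ring

theorem le_sum_card_mul_card_freeVertices [DecidableRel G.Adj] {lam : ℝ} (hlam : 0 < lam) :
    lam * (∑ I ∈ indepFinsets G, ((freeVertices G I).card : ℝ) ^ 2 * lam ^ I.card -
        (G.maxDegree + 1) *
          ∑ I ∈ indepFinsets G, ((freeVertices G I).card : ℝ) * lam ^ I.card) ≤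
      ∑ I ∈ indepFinsets G, (I.card : ℝ) * (freeVertices G I).card * lam ^ I.card := by
  classical
  rw [sum_card_mul_eq_sum_freeVertices lam fun I => ((freeVertices G I).card : ℝ),
    Finset.mul_sum, ← Finset.sum_sub_distrib]
  refine mul_le_mul_of_nonneg_left (Finset.sum_le_sum fun J _ => ?_) hlam.le
  have hb : ∑ _v ∈ freeVertices G J, (((freeVertices G J).card : ℝ) - (G.maxDegree + 1)) ≤
      ∑ v ∈ freeVertices G J, ((freeVertices G (insert v J)).card : ℝ) :=
    Finset.sum_le_sum fun v _ => by
      rw [sub_le_iff_le_add]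
      exact_mod_cast card_freeVertices_le_insert J v
  rw [Finset.sum_const, nsmul_eq_mul] at hb
  have := mul_le_mul_of_nonneg_right hb (pow_pos hlam J.card).le
  linarith

theorem card_mul_indepPoly_le [DecidableRel G.Adj] {lam : ℝ} (hlam : 0 < lam) :
    Fintype.card V * indepPoly G lam ≤
      ∑ I ∈ indepFinsets G, ((freeVertices G I).card : ℝ) * lam ^ I.card +
        (G.maxDegree + 1) * ∑ I ∈ indepFinsets G, (I.card : ℝ) * lam ^ I.card := by
  rw [indepPoly, Finset.mul_sum, Finset.mul_sum, ← Finset.sum_add_distrib]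
  refine Finset.sum_le_sum fun I _ => ?_
  have h : (Fintype.card V : ℝ) ≤ (freeVertices G I).card + I.card * (G.maxDegree + 1) :=
    mod_cast card_le_card_freeVertices_add I
  have := mul_le_mul_of_nonneg_right h (pow_pos hlam I.card).le
  linarith

/-- Cauchy–Schwarz applied to `|I|` and `|I| - lam * F`, where `F` counts free vertices. -/
theorem sum_card_le_mul_variance [DecidableRel G.Adj] {lam : ℝ} (hlam : 0 < lam) :
    ∑ I ∈ indepFinsets G, (I.card : ℝ) * lam ^ I.card ≤
      (1 + (G.maxDegree + 1) * lam) *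
        (∑ I ∈ indepFinsets G, (I.card : ℝ) ^ 2 * lam ^ I.card -
          (∑ I ∈ indepFinsets G, (I.card : ℝ) * lam ^ I.card) ^ 2 / indepPoly G lam) := by
  have hZ := indepPoly_pos (G := G) hlam
  have hA := sum_card_eq (G := G) lam
  have hB := sum_card_sq_eq (G := G) lam
  have hC := le_sum_card_mul_card_freeVertices (G := G) hlam
  have hA0 : 0 ≤ ∑ I ∈ indepFinsets G, (I.card : ℝ) * lam ^ I.card :=
    Finset.sum_nonneg fun _ _ => by positivity
  have hZdef : indepPoly G lam = ∑ I ∈ indepFinsets G, lam ^ I.card := rfl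
  set Z := indepPoly G lam
  set A := ∑ I ∈ indepFinsets G, (I.card : ℝ) * lam ^ I.card with hAdef
  set B := ∑ I ∈ indepFinsets G, (I.card : ℝ) ^ 2 * lam ^ I.card with hBdef
  set Φ := ∑ I ∈ indepFinsets G, ((freeVertices G I).card : ℝ) * lam ^ I.card with hΦdef
  set C := ∑ I ∈ indepFinsets G, (I.card : ℝ) * (freeVertices G I).card * lam ^ I.card
    with hCdef
  set D := ∑ I ∈ indepFinsets G, ((freeVertices G I).card : ℝ) ^ 2 * lam ^ I.card with hDdef
  have hVar : ∑ I ∈ indepFinsets G, ((I.card : ℝ) - A / Z) ^ 2 * lam ^ I.card =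
      B - A ^ 2 / Z := by
    have h : ∑ I ∈ indepFinsets G, ((I.card : ℝ) - A / Z) ^ 2 * lam ^ I.card =
        B - 2 * (A / Z) * A + (A / Z) ^ 2 * Z := by
      rw [hBdef, hZdef]
      nth_rw 3 [hAdef]
      simp_rw [Finset.mul_sum]
      rw [← Finset.sum_sub_distrib, ← Finset.sum_add_distrib]
      exact Finset.sum_congr rfl fun _ _ => by ring
    rw [h]
    field_simp
    ring
  have hX : ∑ I ∈ indepFinsets G, ((I.card : ℝ) - lam * (freeVertices G I).card) ^ 2 *
      lam ^ I.card = B - 2 * lam * C + lam ^ 2 * D := by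
    rw [hBdef, hCdef, hDdef, Finset.mul_sum, Finset.mul_sum, ← Finset.sum_sub_distrib,
      ← Finset.sum_add_distrib]
    exact Finset.sum_congr rfl fun _ _ => by ring
  have hCov : ∑ I ∈ indepFinsets G, ((I.card : ℝ) - A / Z) *
      ((I.card : ℝ) - lam * (freeVertices G I).card) * lam ^ I.card = A := by
    have h : ∑ I ∈ indepFinsets G, ((I.card : ℝ) - A / Z) *
        ((I.card : ℝ) - lam * (freeVertices G I).card) * lam ^ I.card =
        B - lam * C - A / Z * (A - lam * Φ) := by
      rw [hBdef, hCdef, hΦdef]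
      nth_rw 3 [hAdef]
      rw [Finset.mul_sum, Finset.mul_sum, ← Finset.sum_sub_distrib, ← Finset.sum_sub_distrib,
        Finset.mul_sum, ← Finset.sum_sub_distrib]
      exact Finset.sum_congr rfl fun _ _ => by ring
    rw [h]
    linear_combination hB - (1 + A / Z) * hA
  have hCS := Finset.sum_sq_le_sum_mul_sum_of_sq_le_mul (indepFinsets G)
    (r := fun I => ((I.card : ℝ) - A / Z) *
      ((I.card : ℝ) - lam * (freeVertices G I).card) * lam ^ I.card)
    (f := fun I => ((I.card : ℝ) - A / Z) ^ 2 * lam ^ I.card)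
    (g := fun I => ((I.card : ℝ) - lam * (freeVertices G I).card) ^ 2 * lam ^ I.card)
    (fun _ _ => by positivity) (fun _ _ => by positivity) (fun _ _ => le_of_eq (by ring))
  have hVar0 : 0 ≤ B - A ^ 2 / Z := hVar ▸ Finset.sum_nonneg fun _ _ => by positivity
  rw [hVar, hX, hCov] at hCS
  have hXle : B - 2 * lam * C + lam ^ 2 * D ≤ (1 + (G.maxDegree + 1) * lam) * A := by
    have := mul_le_mul_of_nonneg_left hC hlam.le
    linear_combination this + hB - (1 + lam * (G.maxDegree + 1)) * hA
  rcases hA0.eq_or_lt with h0 | hpos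
  · rw [← h0] at hVar0 ⊢
    positivity
  · refine le_of_mul_le_mul_right ?_ hpos
    have := mul_le_mul_of_nonneg_left hXle hVar0
    linarith

end HardCore

/-- Theorem 5: for an `n`-vertex graph `G` with maximum degree `Δ` and `λ > 0`, the variance
of the size of a random independent set from the hard-core model satisfies
`Var(|I|) ≥ nλ/(1+(Δ+1)λ)²`, i.e. `V_G(λ) ≥ V_{K_{Δ+1}}(λ) = λ/(1+(Δ+1)λ)²`. -/
theorem variance_lower_bound_maxDegree {V : Type*} [Fintype V] (G : SimpleGraph V)
    [DecidableRel G.Adj] (n Δ : ℕ) (hn : Fintype.card V = n)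
    (hΔ : G.maxDegree = Δ) (lam : ℝ) (hlam : 0 < lam) :
    (∑ I ∈ indepFinsets G, (I.card : ℝ) ^ 2 * lam ^ I.card) / indepPoly G lam -
        ((∑ I ∈ indepFinsets G, (I.card : ℝ) * lam ^ I.card) / indepPoly G lam) ^ 2 ≥
      (n : ℝ) * lam / (1 + ((Δ : ℝ) + 1) * lam) ^ 2 := by
  subst hn hΔ
  have hZ := indepPoly_pos (G := G) hlam
  have hk : 0 < 1 + ((G.maxDegree : ℝ) + 1) * lam := by positivity
  have hVar := sum_card_le_mul_variance (G := G) hlam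
  have hn := mul_le_mul_of_nonneg_left (card_mul_indepPoly_le (G := G) hlam) hlam.le
  rw [mul_add, ← sum_card_eq] at hn
  set Z := indepPoly G lam
  set A := ∑ I ∈ indepFinsets G, (I.card : ℝ) * lam ^ I.card
  set B := ∑ I ∈ indepFinsets G, (I.card : ℝ) ^ 2 * lam ^ I.card
  have hmain : (Fintype.card V : ℝ) * lam * Z ≤
      (B - A ^ 2 / Z) * (1 + ((G.maxDegree : ℝ) + 1) * lam) ^ 2 := by
    have := mul_le_mul_of_nonneg_left hVar hk.le
    linarith
  have hdiv : B / Z - (A / Z) ^ 2 = (B - A ^ 2 / Z) / Z := by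
    field_simp
  rw [ge_iff_le, hdiv, div_le_div_iff₀ (by positivity) hZ]
  exact hmain
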